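/- Assume α, β, γ are positive irrational numbers with α + β + γ = 1, β < 1/2 and α < γ, and assume in addition that 1, α, β are linearly independent over ℚ. With E_β and E_γ as defined in the context: E_β(n) = 1 with density αβ/2, E_β(n) = −1 with density αβ/2, and E_β(n) = 0 with density 1 − αβ; E_γ(n) = 1 with density 1/8 − αβ/2, E_γ(n) = −1 with density 1/8 − αβ/2, and E_γ(n) = 0 with density 3/4 + αβ. (Here 'f(n) = c with density κ' means lim_{N→∞} (1/N)·#{n ≤ N : f(n) = c} = κ.) -/

import Mathlib

open Filter

/-- The `n`-th term of the Webster sequence of density `d`: `⌈(n - 1/2)/d⌉`. -/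
noncomputable def wTerm (d : ℝ) (n : ℕ) : ℕ := ⌈((n : ℝ) - 1/2) / d⌉₊

/-- The Webster sequence of density `d`, as a set of positive integers. -/
def wSet (d : ℝ) : Set ℕ := {m : ℕ | ∃ n : ℕ, 1 ≤ n ∧ m = wTerm d n}

/-- Counting function of a set of positive integers: `S(m) = #{k ∈ S : k ≤ m}`. -/
noncomputable def wCount (S : Set ℕ) (m : ℕ) : ℕ := (S ∩ Set.Iic m).ncard

/-- `u_n = {nd + 1/2}` (fractional part), for density `d`. -/
noncomputable def fpart (d : ℝ) (n : ℕ) : ℝ := Int.fract ((n : ℝ) * d + 1/2)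

/-- The set `W̃_α` of Algorithm 2. -/
def WtA (α : ℝ) : Set ℕ := {n : ℕ | 1 ≤ n ∧ fpart α n < α}

/-- The set `W̃_β` of Algorithm 2. -/
def WtB (α β : ℝ) : Set ℕ := {n : ℕ | 1 ≤ n ∧
  ((α < fpart α n ∧ fpart β n < β) ∨
   (1 - α < fpart α n ∧ 1 - β/2 < fpart β n) ∨
   (α < fpart α n ∧ fpart α n < 2*α ∧ β < fpart β n ∧ fpart β n < 3*β/2))}

/-- The set `W̃_γ` of Algorithm 2. -/
def WtC (α β : ℝ) : Set ℕ := {n : ℕ | 1 ≤ n} \ (WtA α ∪ WtB α β)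

/-- `E_β(n) = W̃_β(n) − W_β(n)`. -/
noncomputable def Ebeta (α β : ℝ) (n : ℕ) : ℤ :=
  (wCount (WtB α β) n : ℤ) - (wCount (wSet β) n : ℤ)

/-- `E_γ(n) = W̃_γ(n) − W_γ(n)`. -/
noncomputable def Egamma (α β γ : ℝ) (n : ℕ) : ℤ :=
  (wCount (WtC α β) n : ℤ) - (wCount (wSet γ) n : ℤ)

/-- `f(n) = c` holds with density `κ`. -/
def HasDensity (f : ℕ → ℤ) (c : ℤ) (κ : ℝ) : Prop :=
  Tendsto (fun N : ℕ => ({n : ℕ | 1 ≤ n ∧ n ≤ N ∧ f n = c}.ncard : ℝ) / N)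
    atTop (nhds κ)


section Torus

open MeasureTheory Set Topology
open scoped ENNReal

variable {d : Type*}

/-- The projection `ℝᵈ → (ℝ/ℤ)ᵈ`. -/
def torusMk (y : d → ℝ) : UnitAddTorus d := fun i => (y i : UnitAddCircle)

/-- The representative in `[0,1)ᵈ` of a point of the torus. -/
noncomputable def torusRep (x : UnitAddTorus d) : d → ℝ :=
  fun i => (AddCircle.equivIco (1 : ℝ) 0 (x i) : ℝ)

lemma continuous_torusMk : Continuous (torusMk : (d → ℝ) → UnitAddTorus d) := by
  unfold torusMk
  exact continuous_pi fun i => (AddCircle.continuous_mk' 1).comp (continuous_apply i)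

lemma torusRep_torusMk (y : d → ℝ) : torusRep (torusMk y) = fun i => Int.fract (y i) := by
  funext i
  simp [torusRep, torusMk]

lemma torusRep_torusMk_of_mem {y : d → ℝ} (hy : y ∈ univ.pi fun _ : d => Ioo (0 : ℝ) 1) :
    torusRep (torusMk y) = y := by
  rw [torusRep_torusMk]
  funext i
  exact Int.fract_eq_self.2 ⟨(hy i trivial).1.le, (hy i trivial).2⟩

lemma continuousAt_torusRep {x : UnitAddTorus d} (hx : ∀ i, x i ≠ 0) :
    ContinuousAt torusRep x := by
  refine continuousAt_pi.2 fun i => ?_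
  have h1 : ContinuousAt (AddCircle.equivIco (1 : ℝ) 0) (x i) :=
    AddCircle.continuousAt_equivIco 1 0 (by simpa using hx i)
  exact continuousAt_subtype_val.comp
    (h1.comp (f := fun y : UnitAddTorus d => y i) (continuous_apply i).continuousAt)

variable [Fintype d]

/-- Lebesgue measure on the open unit cube. -/
noncomputable def cubeMeasure (d : Type*) [Fintype d] : Measure (d → ℝ) :=
  Measure.pi fun _ => (volume : Measure ℝ).restrict (Ioo 0 1)

lemma cubeMeasure_eq_restrict :
    cubeMeasure d = volume.restrict (univ.pi fun _ => Ioo (0 : ℝ) 1) := by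
  rw [cubeMeasure, volume_pi, Measure.restrict_pi_pi]

instance : IsProbabilityMeasure ((volume : Measure ℝ).restrict (Ioo 0 1)) :=
  ⟨by simp⟩

instance : IsProbabilityMeasure (cubeMeasure d) := by
  unfold cubeMeasure; infer_instance

/-- The uniform probability measure on the torus. -/
noncomputable def torusMeasure (d : Type*) [Fintype d] : ProbabilityMeasure (UnitAddTorus d) :=
  ⟨(cubeMeasure d).map torusMk,
    Measure.isProbabilityMeasure_map continuous_torusMk.measurable.aemeasurable⟩

lemma integral_fourier_unit {n : ℤ} (hn : n ≠ 0) :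
    ∫ x in Ioo (0 : ℝ) 1, fourier n (x : UnitAddCircle) = 0 := by
  rw [← integral_Ioc_eq_integral_Ioo, ← intervalIntegral.integral_of_le zero_le_one]
  have hc : (2 * Real.pi * Complex.I * n : ℂ) ≠ 0 := by
    simp [hn, Real.pi_ne_zero]
  have := integral_exp_mul_complex (a := 0) (b := 1) hc
  have h1 : Complex.exp (2 * Real.pi * Complex.I * n) = 1 :=
    Complex.exp_eq_one_iff.2 ⟨n, by ring⟩
  simpa [fourier_coe_apply, h1] using this

lemma integral_mFourier_torusMeasure {n : d → ℤ} (hn : n ≠ 0) :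
    ∫ x, UnitAddTorus.mFourier n x ∂(torusMeasure d : Measure (UnitAddTorus d)) = 0 := by
  change ∫ x, UnitAddTorus.mFourier n x ∂((cubeMeasure d).map torusMk) = 0
  rw [integral_map continuous_torusMk.measurable.aemeasurable
    (by exact (UnitAddTorus.mFourier n).continuous.aestronglyMeasurable)]
  obtain ⟨i, hi⟩ := Function.ne_iff.1 hn
  simp only [UnitAddTorus.mFourier, ContinuousMap.coe_mk, torusMk, cubeMeasure]
  rw [integral_fintype_prod_eq_prod (fun i (x : ℝ) => fourier (n i) (x : UnitAddCircle))]
  exact Finset.prod_eq_zero (Finset.mem_univ i) (integral_fourier_unit hi)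

/-- The average of `f` over the first `N` terms of the sequence `x`. -/
noncomputable def seqAvg {X : Type*} (x : ℕ → X) (f : X → ℂ) (N : ℕ) : ℂ :=
  (∑ k ∈ Finset.range N, f (x k)) / N

lemma norm_seqAvg_le {X : Type*} (x : ℕ → X) (f : X → ℂ) {C : ℝ} (hC : 0 ≤ C)
    (hf : ∀ y, ‖f y‖ ≤ C) (N : ℕ) : ‖seqAvg x f N‖ ≤ C := by
  rw [seqAvg, norm_div, Complex.norm_natCast]
  refine div_le_of_le_mul₀ (by positivity) hC ?_
  refine (norm_sum_le _ _).trans ?_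
  refine (Finset.sum_le_sum fun k _ => hf (x k)).trans ?_
  simp [mul_comm]

/-- Weyl's criterion: averages of continuous functions converge as soon as those of the
nontrivial characters tend to `0`. -/
theorem tendsto_seqAvg_of_mFourier {x : ℕ → UnitAddTorus d}
    (h : ∀ n : d → ℤ, n ≠ 0 → Tendsto (seqAvg x (UnitAddTorus.mFourier n)) atTop (𝓝 0))
    (f : C(UnitAddTorus d, ℂ)) :
    Tendsto (seqAvg x f) atTop
      (𝓝 (∫ y, f y ∂(torusMeasure d : Measure (UnitAddTorus d)))) := by
  set μ : Measure (UnitAddTorus d) := (torusMeasure d : Measure (UnitAddTorus d))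
  have h_int (g : C(UnitAddTorus d, ℂ)) : Integrable g μ :=
    (BoundedContinuousFunction.mkOfCompact g).integrable μ
  have hspan : ∀ g ∈ Submodule.span ℂ (range (UnitAddTorus.mFourier (d := d))),
      Tendsto (seqAvg x g) atTop (𝓝 (∫ y, g y ∂μ)) := by
    intro g hg
    induction hg using Submodule.span_induction with
    | mem g hg =>
      obtain ⟨n, rfl⟩ := hg
      by_cases hn : n = 0
      · subst hn
        refine tendsto_const_nhds.congr' ?_
        filter_upwards [eventually_ne_atTop 0] with N hN
        simp [seqAvg, UnitAddTorus.mFourier_zero, hN]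
      · rw [integral_mFourier_torusMeasure hn]
        exact h n hn
    | zero => simpa using (tendsto_const_nhds (x := (0 : ℂ))).congr fun N => by simp [seqAvg]
    | add g₁ g₂ _ _ h₁ h₂ =>
      have := h₁.add h₂
      rw [← integral_add (h_int g₁) (h_int g₂)] at this
      refine this.congr fun N => ?_
      simp [seqAvg, Finset.sum_add_distrib, add_div]
    | smul c g _ hg =>
      have := hg.const_mul c
      rw [← integral_const_mul] at this
      refine this.congr fun N => ?_
      simp [seqAvg, ← Finset.mul_sum, mul_div_assoc]
  rw [Metric.tendsto_atTop]
  intro ε hε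
  have hf : f ∈ (Submodule.span ℂ (range (UnitAddTorus.mFourier (d := d)))).topologicalClosure := by
    rw [UnitAddTorus.span_mFourier_closure_eq_top]; trivial
  obtain ⟨g, hg, hfg⟩ := Metric.mem_closure_iff.1 hf (ε / 3) (by positivity)
  obtain ⟨M, hM⟩ := Metric.tendsto_atTop.1 (hspan g hg) (ε / 3) (by positivity)
  refine ⟨M, fun N hN => ?_⟩
  have hb : ∀ y, ‖f y - g y‖ ≤ ε / 3 := fun y => by
    rw [← dist_eq_norm]
    exact (ContinuousMap.dist_apply_le_dist y).trans hfg.le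
  have h1 : ‖seqAvg x f N - seqAvg x g N‖ ≤ ε / 3 := by
    have := norm_seqAvg_le x (fun y => f y - g y) (by positivity) hb N
    simpa [seqAvg, Finset.sum_sub_distrib, sub_div] using this
  have h2 : ‖∫ y, f y ∂μ - ∫ y, g y ∂μ‖ ≤ ε / 3 := by
    rw [← integral_sub (h_int f) (h_int g)]
    simpa using norm_integral_le_of_norm_le_const (μ := μ) (ae_of_all _ hb)
  have h3 := hM N hN
  rw [dist_eq_norm] at h3 ⊢
  calc ‖seqAvg x f N - ∫ y, f y ∂μ‖
      = ‖(seqAvg x f N - seqAvg x g N) + (seqAvg x g N - ∫ y, g y ∂μ)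
          - (∫ y, f y ∂μ - ∫ y, g y ∂μ)‖ := by congr 1; ring
    _ ≤ ‖seqAvg x f N - seqAvg x g N‖ + ‖seqAvg x g N - ∫ y, g y ∂μ‖
          + ‖∫ y, f y ∂μ - ∫ y, g y ∂μ‖ := norm_sub_le_of_le (norm_add_le _ _) le_rfl
    _ < ε := by linarith

/-- The uniform probability measure on the first `N + 1` terms of a sequence. -/
noncomputable def empiricalMeasure {X : Type*} [MeasurableSpace X] (x : ℕ → X) (N : ℕ) :
    ProbabilityMeasure X :=
  ⟨((N : ℝ≥0∞) + 1)⁻¹ • ∑ k ∈ Finset.range (N + 1), Measure.dirac (x k), ⟨by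
    simp only [Measure.smul_apply, Measure.coe_finsetSum, Finset.sum_apply, measure_univ,
      Finset.sum_const, Finset.card_range, smul_eq_mul, nsmul_eq_mul, mul_one]
    push_cast
    exact ENNReal.inv_mul_cancel (by simp) (by simp)⟩⟩

lemma integral_empiricalMeasure {X : Type*} [MeasurableSpace X] [TopologicalSpace X]
    [OpensMeasurableSpace X] [MeasurableSingletonClass X] (x : ℕ → X) (N : ℕ) (f : X → ℂ) :
    ∫ y, f y ∂(empiricalMeasure x N : Measure X) = seqAvg x f (N + 1) := by
  change ∫ y, f y ∂(((N : ℝ≥0∞) + 1)⁻¹ • ∑ k ∈ Finset.range (N + 1), Measure.dirac (x k)) = _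
  rw [integral_smul_measure, integral_finsetSum_measure fun k _ => integrable_dirac (by simp)]
  simp only [integral_dirac, seqAvg, div_eq_inv_mul, Complex.real_smul]
  congr 1
  have : ((N : ℝ≥0∞) + 1) = ((N + 1 : ℕ) : ℝ≥0∞) := by push_cast; rfl
  rw [this, ENNReal.toReal_inv, ENNReal.toReal_natCast]
  push_cast
  rfl

lemma tendsto_empiricalMeasure_of_mFourier {x : ℕ → UnitAddTorus d}
    (h : ∀ n : d → ℤ, n ≠ 0 → Tendsto (seqAvg x (UnitAddTorus.mFourier n)) atTop (𝓝 0)) :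
    Tendsto (empiricalMeasure x) atTop (𝓝 (torusMeasure d)) := by
  rw [ProbabilityMeasure.tendsto_iff_forall_integral_rclike_tendsto ℂ]
  intro f
  simp_rw [integral_empiricalMeasure]
  exact (tendsto_add_atTop_iff_nat 1).2 (tendsto_seqAvg_of_mFourier h f.toContinuousMap)

lemma frontier_preimage_subset {X Y : Type*} [TopologicalSpace X] [TopologicalSpace Y]
    {f : X → Y} {s : Set Y} {x : X} (hf : ContinuousAt f x) (hx : x ∈ frontier (f ⁻¹' s)) :
    f x ∈ frontier s := by
  rw [frontier_eq_closure_inter_closure] at hx ⊢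
  exact ⟨closure_mono (image_preimage_subset f s) (mem_closure_image hf hx.1),
    closure_mono (by rw [← preimage_compl]; exact image_preimage_subset f sᶜ)
      (mem_closure_image hf hx.2)⟩

lemma torusMeasure_frontier_preimage {C : Set (d → ℝ)} (hC : Convex ℝ C) :
    (torusMeasure d : Measure (UnitAddTorus d)) (frontier (torusRep ⁻¹' C)) = 0 := by
  change (cubeMeasure d).map torusMk (frontier (torusRep ⁻¹' C)) = 0
  rw [Measure.map_apply continuous_torusMk.measurable isClosed_frontier.measurableSet,
    cubeMeasure_eq_restrict, Measure.restrict_apply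
      (continuous_torusMk.measurable isClosed_frontier.measurableSet)]
  refine measure_mono_null ?_ (hC.addHaar_frontier volume)
  rintro y ⟨hy, hmem⟩
  rw [← torusRep_torusMk_of_mem hmem]
  refine frontier_preimage_subset (continuousAt_torusRep fun i h0 => ?_) hy
  have := congrFun (torusRep_torusMk_of_mem hmem) i
  have h1 := (AddCircle.equivIco_coe_eq (p := (1 : ℝ)) (a := 0) (x := 0) (by simp))
  have h2 := (hmem i trivial).1
  rw [torusRep, h0, ← QuotientAddGroup.mk_zero] at this
  rw [h1] at this
  exact h2.ne this

lemma torusMeasure_preimage {C : Set (d → ℝ)} (hC : Convex ℝ C) :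
    (torusMeasure d : Measure (UnitAddTorus d)) (torusRep ⁻¹' C)
      = volume (C ∩ univ.pi fun _ => Ioo (0 : ℝ) 1) := by
  have hnull := nullMeasurableSet_of_null_frontier (torusMeasure_frontier_preimage hC)
  change (cubeMeasure d).map torusMk (torusRep ⁻¹' C) = _
  have hbox : MeasurableSet (univ.pi fun _ : d => Ioo (0 : ℝ) 1) :=
    MeasurableSet.univ_pi fun _ => measurableSet_Ioo
  rw [Measure.map_apply₀ continuous_torusMk.measurable.aemeasurable hnull,
    cubeMeasure_eq_restrict, Measure.restrict_apply' hbox]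
  congr 1
  ext y
  simp only [mem_inter_iff, mem_preimage]
  refine and_congr_left fun hy => ?_
  rw [torusRep_torusMk_of_mem hy]

open Classical in
/-- A sequence satisfying Weyl's criterion visits a convex subset of the unit cube with frequency
equal to its volume. -/
theorem tendsto_card_fract_mem_of_mFourier {y : ℕ → d → ℝ}
    (h : ∀ n : d → ℤ, n ≠ 0 →
      Tendsto (seqAvg (fun k => torusMk (y k)) (UnitAddTorus.mFourier n)) atTop (𝓝 0))
    {C : Set (d → ℝ)} (hC : Convex ℝ C) :
    Tendsto (fun N : ℕ =>
      (((Finset.range N).filter fun k => (fun i => Int.fract (y k i)) ∈ C).card : ℝ) / N) atTop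
      (𝓝 (volume (C ∩ univ.pi fun _ => Ioo (0 : ℝ) 1)).toReal) := by
  have h1 := ProbabilityMeasure.tendsto_measure_of_null_frontier_of_tendsto'
    (tendsto_empiricalMeasure_of_mFourier h) (torusMeasure_frontier_preimage hC)
  rw [torusMeasure_preimage hC] at h1
  have hfin : volume (C ∩ univ.pi fun _ => Ioo (0 : ℝ) 1) ≠ ∞ := by
    rw [← torusMeasure_preimage hC]
    exact measure_ne_top _ _
  rw [← tendsto_add_atTop_iff_nat 1]
  refine ((ENNReal.tendsto_toReal hfin).comp h1).congr fun N => ?_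
  change ((((N : ℝ≥0∞) + 1)⁻¹ • ∑ k ∈ Finset.range (N + 1),
    Measure.dirac (torusMk (y k)) : Measure _) (torusRep ⁻¹' C)).toReal = _
  simp only [Measure.smul_apply, Measure.coe_finsetSum, Finset.sum_apply, Measure.dirac_apply,
    smul_eq_mul, ENNReal.toReal_mul, ENNReal.toReal_inv, indicator_apply, mem_preimage,
    torusRep_torusMk, Pi.one_apply, Finset.sum_boole, ENNReal.toReal_natCast]
  have : ((N : ℝ≥0∞) + 1) = ((N + 1 : ℕ) : ℝ≥0∞) := by push_cast; rfl
  rw [this, ENNReal.toReal_natCast, div_eq_inv_mul]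

end Torus

section Kronecker

open MeasureTheory Set Topology

variable {d : Type*} [Fintype d]

lemma tendsto_seqAvg_geometric {z : ℂ} (hz : ‖z‖ = 1) (hz1 : z ≠ 1) (c : ℂ) :
    Tendsto (seqAvg (fun k => c * z ^ k) id) atTop (𝓝 0) := by
  have hpos : 0 < ‖z - 1‖ := norm_pos_iff.2 (sub_ne_zero.2 hz1)
  refine squeeze_zero_norm (a := fun N : ℕ => ‖c‖ * (2 / ‖z - 1‖) / N) (fun N => ?_)
    (tendsto_const_div_atTop_nhds_zero_nat _)
  simp only [seqAvg, id, ← Finset.mul_sum, geom_sum_eq hz1, norm_div, norm_mul,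
    Complex.norm_natCast]
  gcongr
  refine (norm_sub_le _ _).trans ?_
  simp [hz]
  norm_num

lemma mFourier_torusMk (n : d → ℤ) (y : d → ℝ) :
    UnitAddTorus.mFourier n (torusMk y)
      = Complex.exp (2 * Real.pi * Complex.I * ∑ i, (n i : ℂ) * (y i : ℂ)) := by
  simp only [UnitAddTorus.mFourier, ContinuousMap.coe_mk, torusMk, fourier_coe_apply,
    Finset.mul_sum, Complex.exp_sum]
  refine Finset.prod_congr rfl fun i _ => ?_
  congr 1
  push_cast
  ring

/-- Kronecker sequences `k a + b` with `1, a₁, …, a_d` rationally independent satisfy Weyl's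
criterion. -/
theorem tendsto_seqAvg_mFourier_of_independent {a : d → ℝ} (b : d → ℝ)
    (ha : ∀ n : d → ℤ, n ≠ 0 → ∀ m : ℤ, ∑ i, (n i : ℝ) * a i ≠ m) (n : d → ℤ) (hn : n ≠ 0) :
    Tendsto (seqAvg (fun k : ℕ => torusMk fun i => k * a i + b i) (UnitAddTorus.mFourier n))
      atTop (𝓝 0) := by
  set θ : ℝ := ∑ i, (n i : ℝ) * a i with hθ
  have hz : ‖Complex.exp (2 * Real.pi * Complex.I * θ)‖ = 1 := by
    have := Complex.norm_exp_ofReal_mul_I (2 * Real.pi * θ)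
    rw [← this]
    congr 2
    push_cast
    ring
  have hz1 : Complex.exp (2 * Real.pi * Complex.I * θ) ≠ 1 := by
    intro h
    obtain ⟨m, hm⟩ := Complex.exp_eq_one_iff.1 h
    have hc : (2 * Real.pi * Complex.I : ℂ) ≠ 0 := by simp [Real.pi_ne_zero]
    have : (θ : ℂ) = m := mul_left_cancel₀ hc (by rw [hm]; ring)
    exact ha n hn m (by exact_mod_cast this)
  refine (tendsto_seqAvg_geometric hz hz1
    (Complex.exp (2 * Real.pi * Complex.I * ∑ i, (n i : ℂ) * (b i : ℂ)))).congr fun N => ?_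
  simp only [seqAvg, id]
  congr 1
  refine Finset.sum_congr rfl fun k _ => ?_
  rw [mFourier_torusMk, ← Complex.exp_nat_mul, ← Complex.exp_add]
  congr 1
  rw [hθ]
  push_cast
  simp only [mul_add, Finset.sum_add_distrib, Finset.mul_sum]
  rw [add_comm]
  congr 1
  exact Finset.sum_congr rfl fun i _ => by ring

end Kronecker

section Density

open Topology MeasureTheory Set

/-- The set of positive integers satisfying `P` has natural density `κ`. -/
def PredDensity (P : ℕ → Prop) (κ : ℝ) : Prop :=
  Tendsto (fun N : ℕ => ({n : ℕ | 1 ≤ n ∧ n ≤ N ∧ P n}.ncard : ℝ) / N) atTop (𝓝 κ)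

lemma finite_setOf_le_and (P : ℕ → Prop) (N : ℕ) : {n : ℕ | 1 ≤ n ∧ n ≤ N ∧ P n}.Finite :=
  (finite_Iic N).subset fun _ h => h.2.1

lemma PredDensity.congr {P Q : ℕ → Prop} {κ : ℝ} (h : PredDensity P κ)
    (hPQ : ∀ n, 1 ≤ n → (P n ↔ Q n)) : PredDensity Q κ := by
  refine Tendsto.congr (fun N => ?_) h
  congr 3
  ext n
  exact and_congr_right fun hn => and_congr_right fun _ => hPQ n hn

lemma PredDensity.and_not {P Q : ℕ → Prop} {κ l : ℝ} (hP : PredDensity P κ)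
    (hQ : PredDensity Q l) (hQP : ∀ n, 1 ≤ n → Q n → P n) :
    PredDensity (fun n => P n ∧ ¬ Q n) (κ - l) := by
  refine Tendsto.congr (fun N => ?_) (Tendsto.sub hP hQ)
  have hsub : {n : ℕ | 1 ≤ n ∧ n ≤ N ∧ Q n} ⊆ {n : ℕ | 1 ≤ n ∧ n ≤ N ∧ P n} :=
    fun n hn => ⟨hn.1, hn.2.1, hQP n hn.1 hn.2.2⟩
  have h := ncard_sdiff_add_ncard_of_subset hsub (finite_setOf_le_and P N)
  have hset : {n : ℕ | 1 ≤ n ∧ n ≤ N ∧ P n} \ {n : ℕ | 1 ≤ n ∧ n ≤ N ∧ Q n}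
      = {n : ℕ | 1 ≤ n ∧ n ≤ N ∧ P n ∧ ¬ Q n} := by
    ext n
    simp only [Set.mem_sdiff, mem_ofPred_eq]
    tauto
  rw [← sub_div, ← hset, ← h]
  push_cast
  ring

lemma predDensity_true : PredDensity (fun _ => True) 1 := by
  refine tendsto_const_nhds.congr' ?_
  filter_upwards [eventually_ne_atTop 0] with N hN
  have : {n : ℕ | 1 ≤ n ∧ n ≤ N ∧ True} = Icc 1 N := by
    ext n
    simp
  rw [this, ncard_eq_toFinset_card']
  simp [hN]

open Classical in
lemma ncard_setOf_le_and (P : ℕ → Prop) (N : ℕ) :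
    {n : ℕ | 1 ≤ n ∧ n ≤ N ∧ P n}.ncard
      = ((Finset.range N).filter fun k => P (k + 1)).card := by
  rw [← Finset.card_image_of_injective _ (add_left_injective 1), ← ncard_coe_finset]
  congr 1
  ext n
  simp only [mem_ofPred_eq, Finset.coe_image, Finset.coe_filter, Finset.mem_range, mem_image]
  constructor
  · rintro ⟨h1, h2, h3⟩
    exact ⟨n - 1, ⟨by omega, by rwa [Nat.sub_add_cancel h1]⟩, by omega⟩
  · rintro ⟨k, ⟨hk, hP⟩, rfl⟩
    exact ⟨by omega, by omega, hP⟩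

lemma predDensity_of_convex {α β : ℝ} (hindep : LinearIndependent ℚ ![(1 : ℝ), α, β])
    {C : Set (Fin 2 → ℝ)} (hC : Convex ℝ C) {κ : ℝ} (hκ : 0 ≤ κ)
    (hvol : volume (C ∩ univ.pi fun _ => Ioo (0 : ℝ) 1) = ENNReal.ofReal κ) :
    PredDensity (fun n => ![fpart α n, fpart β n] ∈ C) κ := by
  classical
  have ha : ∀ n : Fin 2 → ℤ, n ≠ 0 → ∀ m : ℤ, ∑ i, (n i : ℝ) * ![α, β] i ≠ m := by
    intro n hn m h
    have := Fintype.linearIndependent_iff.1 hindep ![-(m : ℚ), (n 0 : ℚ), (n 1 : ℚ)] (by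
      simp [Fin.sum_univ_succ, Rat.smul_def] at h ⊢
      linarith)
    have h1 := this 1
    have h2 := this 2
    simp at h1 h2
    exact hn (by ext i; fin_cases i <;> simp [h1, h2])
  have h := tendsto_card_fract_mem_of_mFourier
    (tendsto_seqAvg_mFourier_of_independent ![α + 1/2, β + 1/2] ha) hC
  rw [hvol, ENNReal.toReal_ofReal hκ] at h
  refine h.congr fun N => ?_
  rw [ncard_setOf_le_and]
  congr 3
  refine Finset.filter_congr fun k _ => ?_
  have : (fun i => Int.fract ((k : ℝ) * ![α, β] i + ![α + 1/2, β + 1/2] i))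
      = ![fpart α (k + 1), fpart β (k + 1)] := by
    ext i
    fin_cases i <;> simp [fpart] <;> congr 1 <;> ring
  rw [this]

lemma isLinear_coord (i : Fin 2) : IsLinearMap ℝ fun y : Fin 2 → ℝ => y i :=
  (LinearMap.proj i : (Fin 2 → ℝ) →ₗ[ℝ] ℝ).isLinear

lemma predDensity_lt_and_lt {α β : ℝ} (hindep : LinearIndependent ℚ ![(1 : ℝ), α, β])
    {s t : ℝ} (hs : s ∈ Icc (0 : ℝ) 1) (ht : t ∈ Icc (0 : ℝ) 1) :
    PredDensity (fun n => fpart α n < s ∧ fpart β n < t) (s * t) := by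
  refine predDensity_of_convex hindep (C := {y | y 0 < s ∧ y 1 < t}) ?_
    (mul_nonneg hs.1 ht.1) ?_
  · exact (convex_halfSpace_lt (isLinear_coord 0) s).inter
      (convex_halfSpace_lt (isLinear_coord 1) t)
  · have : {y : Fin 2 → ℝ | y 0 < s ∧ y 1 < t} ∩ univ.pi (fun _ => Ioo (0 : ℝ) 1)
        = univ.pi fun i => Ioo ((![0, 0] : Fin 2 → ℝ) i) (![s, t] i) := by
      ext y
      simp [Fin.forall_fin_two]
      have := hs.2
      have := ht.2
      grind
    rw [this, Real.volume_pi_Ioo]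
    simp [ENNReal.ofReal_mul hs.1]

lemma predDensity_gt_and_gt {α β : ℝ} (hindep : LinearIndependent ℚ ![(1 : ℝ), α, β])
    {s t : ℝ} (hs : s ∈ Icc (0 : ℝ) 1) (ht : t ∈ Icc (0 : ℝ) 1) :
    PredDensity (fun n => 1 - s < fpart α n ∧ 1 - t < fpart β n) (s * t) := by
  refine predDensity_of_convex hindep (C := {y | 1 - s < y 0 ∧ 1 - t < y 1}) ?_
    (mul_nonneg hs.1 ht.1) ?_
  · exact (convex_halfSpace_gt (isLinear_coord 0) (1 - s)).inter
      (convex_halfSpace_gt (isLinear_coord 1) (1 - t))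
  · have : {y : Fin 2 → ℝ | 1 - s < y 0 ∧ 1 - t < y 1} ∩ univ.pi (fun _ => Ioo (0 : ℝ) 1)
        = univ.pi fun i => Ioo ((![1 - s, 1 - t] : Fin 2 → ℝ) i) (![1, 1] i) := by
      ext y
      simp [Fin.forall_fin_two]
      have := hs.2
      have := ht.2
      grind
    rw [this, Real.volume_pi_Ioo]
    simp [ENNReal.ofReal_mul hs.1]

lemma volume_preimage_finTwoArrow_regionBetween {f g : ℝ → ℝ} (hf : Continuous f)
    (hg : Continuous g) {a b : ℝ} (hab : a ≤ b) (hfg : ∀ x ∈ Ioo a b, f x ≤ g x) :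
    volume {y : Fin 2 → ℝ | (y 0, y 1) ∈ regionBetween f g (Ioo a b)}
      = ENNReal.ofReal (∫ x in a..b, g x - f x) := by
  have h := (volume_preserving_finTwoArrow ℝ).measure_preimage
    (measurableSet_regionBetween hf.measurable hg.measurable
      (measurableSet_Ioo (a := a) (b := b))).nullMeasurableSet
  rw [intervalIntegral.integral_of_le hab, integral_Ioc_eq_integral_Ioo]
  refine h.trans (volume_regionBetween_eq_integral ?_ ?_ measurableSet_Ioo hfg)
  · exact (hf.integrableOn_Icc (a := a) (b := b)).mono_set Ioo_subset_Icc_self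
  · exact (hg.integrableOn_Icc (a := a) (b := b)).mono_set Ioo_subset_Icc_self

lemma isLinear_coord_add : IsLinearMap ℝ fun y : Fin 2 → ℝ => y 0 + y 1 :=
  ((LinearMap.proj 0 : (Fin 2 → ℝ) →ₗ[ℝ] ℝ) + LinearMap.proj 1).isLinear

lemma predDensity_add_lt {α β : ℝ} (hindep : LinearIndependent ℚ ![(1 : ℝ), α, β]) :
    PredDensity (fun n => fpart α n + fpart β n < 1/2) (1/8) := by
  refine predDensity_of_convex hindep (C := {y | y 0 + y 1 < 1/2})
    (convex_halfSpace_lt isLinear_coord_add _) (by norm_num) ?_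
  have : {y : Fin 2 → ℝ | y 0 + y 1 < 1/2} ∩ univ.pi (fun _ => Ioo (0 : ℝ) 1)
      = {y | (y 0, y 1) ∈ regionBetween (fun _ => 0) (fun x => 1/2 - x) (Ioo 0 (1/2))} := by
    ext y
    simp only [mem_inter_iff, mem_ofPred_eq, Set.mem_pi, Fin.forall_fin_two, mem_univ, mem_Ioo,
      regionBetween]
    grind
  rw [this, volume_preimage_finTwoArrow_regionBetween (by fun_prop) (by fun_prop) (by norm_num)
    (by intro x hx; linarith [hx.2])]
  congr 1
  simp only [sub_zero]
  rw [intervalIntegral.integral_sub (by simp) (by simp), integral_id]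
  norm_num

lemma predDensity_lt_add {α β : ℝ} (hindep : LinearIndependent ℚ ![(1 : ℝ), α, β]) :
    PredDensity (fun n => 3/2 < fpart α n + fpart β n) (1/8) := by
  refine predDensity_of_convex hindep (C := {y | 3/2 < y 0 + y 1})
    (convex_halfSpace_gt isLinear_coord_add _) (by norm_num) ?_
  have : {y : Fin 2 → ℝ | 3/2 < y 0 + y 1} ∩ univ.pi (fun _ => Ioo (0 : ℝ) 1)
      = {y | (y 0, y 1) ∈ regionBetween (fun x => 3/2 - x) (fun _ => 1) (Ioo (1/2) 1)} := by
    ext y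
    simp only [mem_inter_iff, mem_ofPred_eq, Set.mem_pi, Fin.forall_fin_two, mem_univ, mem_Ioo,
      regionBetween]
    grind
  rw [this, volume_preimage_finTwoArrow_regionBetween (by fun_prop) (by fun_prop) (by norm_num)
    (by intro x hx; linarith [hx.1])]
  congr 1
  simp only [← sub_add]
  rw [intervalIntegral.integral_add (by simp) (by simp), integral_id]
  norm_num

end Density

section Webster

open Set

lemma fpart_nonneg (δ : ℝ) (n : ℕ) : 0 ≤ fpart δ n := Int.fract_nonneg _

lemma fpart_lt_one (δ : ℝ) (n : ℕ) : fpart δ n < 1 := Int.fract_lt_one _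

lemma fpart_zero (δ : ℝ) : fpart δ 0 = 1/2 := by
  rw [fpart, Nat.cast_zero, zero_mul, zero_add, Int.fract_eq_self]
  norm_num

lemma floor_add_fpart (δ : ℝ) (n : ℕ) : (⌊n * δ + 1/2⌋ : ℝ) + fpart δ n = n * δ + 1/2 :=
  Int.floor_add_fract _

/-- One step of the rotation by `δ`. -/
lemma fpart_succ_cases {δ : ℝ} (h0 : 0 < δ) (h1 : δ < 1) (n : ℕ) :
    (δ ≤ fpart δ (n + 1) ∧ fpart δ (n + 1) = fpart δ n + δ ∧
      ⌊((n + 1 : ℕ) : ℝ) * δ + 1/2⌋ = ⌊(n : ℝ) * δ + 1/2⌋) ∨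
    (fpart δ (n + 1) < δ ∧ fpart δ (n + 1) = fpart δ n + δ - 1 ∧
      ⌊((n + 1 : ℕ) : ℝ) * δ + 1/2⌋ = ⌊(n : ℝ) * δ + 1/2⌋ + 1) := by
  have e0 := floor_add_fpart δ n
  have e1 := floor_add_fpart δ (n + 1)
  have := fpart_nonneg δ n
  have := fpart_lt_one δ n
  have := fpart_nonneg δ (n + 1)
  have := fpart_lt_one δ (n + 1)
  push_cast at e1 ⊢
  generalize ⌊(n : ℝ) * δ + 1/2⌋ = A at *
  generalize ⌊((n : ℝ) + 1) * δ + 1/2⌋ = B at *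
  have hlo : A - 1 < B := by
    have : ((A - 1 : ℤ) : ℝ) < B := by push_cast; linarith
    exact_mod_cast this
  have hhi : B < A + 2 := by
    have : (B : ℝ) < ((A + 2 : ℤ) : ℝ) := by push_cast; linarith
    exact_mod_cast this
  obtain rfl | rfl : B = A ∨ B = A + 1 := by omega
  · exact Or.inl ⟨by linarith, by linarith, rfl⟩
  · push_cast at e1
    exact Or.inr ⟨by linarith, by linarith, rfl⟩

lemma fpart_ne {δ : ℝ} (hδ : Irrational δ) (n : ℕ) (k l : ℤ) :
    fpart δ n ≠ k * δ / 2 + l := by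
  intro he
  have e := floor_add_fpart δ n
  rw [he] at e
  have h : (2 * (n : ℤ) - k : ℤ) * δ = (2 * (⌊(n : ℝ) * δ + 1/2⌋ + l) - 1 : ℤ) := by
    push_cast
    linarith
  by_cases hk : 2 * (n : ℤ) - k = 0
  · rw [hk, Int.cast_zero, zero_mul] at h
    have : 2 * (⌊(n : ℝ) * δ + 1/2⌋ + l) - 1 = 0 := by exact_mod_cast h.symm
    omega
  · exact (hδ.intCast_mul hk).ne_int _ h

lemma mem_wSet_iff {δ : ℝ} (h0 : 0 < δ) (n : ℕ) :
    n ∈ wSet δ ↔ 1 ≤ n ∧ fpart δ n < δ := by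
  have e := floor_add_fpart δ n
  constructor
  · rintro ⟨k, hk, hn⟩
    have hk' : (1 : ℝ) ≤ k := by exact_mod_cast hk
    have hpos : 0 < wTerm δ k := Nat.ceil_pos.2 (by apply div_pos <;> linarith)
    have hn0 : n ≠ 0 := by omega
    obtain ⟨h2, h3⟩ := (Nat.ceil_eq_iff hn0).1 hn.symm
    rw [Nat.cast_sub (by omega), lt_div_iff₀ h0] at h2
    rw [div_le_iff₀ h0] at h3
    push_cast at h2
    have : (k : ℤ) ≤ ⌊(n : ℝ) * δ + 1/2⌋ := Int.le_floor.2 (by push_cast; linarith)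
    have : (k : ℝ) ≤ ⌊(n : ℝ) * δ + 1/2⌋ := by exact_mod_cast this
    exact ⟨by omega, by linarith⟩
  · rintro ⟨hn, hlt⟩
    have hn' : (1 : ℝ) ≤ n := by exact_mod_cast hn
    have hfl : 0 < ⌊(n : ℝ) * δ + 1/2⌋ := by
      have : (0 : ℝ) < ⌊(n : ℝ) * δ + 1/2⌋ := by nlinarith
      exact_mod_cast this
    obtain ⟨k, hk⟩ := Int.eq_ofNat_of_zero_le hfl.le
    rw [hk] at e hfl
    push_cast at e
    have := fpart_nonneg δ n
    refine ⟨k, by omega, ((Nat.ceil_eq_iff (by omega)).2 ⟨?_, ?_⟩).symm⟩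
    · rw [Nat.cast_sub (by omega), lt_div_iff₀ h0]
      push_cast
      linarith
    · rw [div_le_iff₀ h0]
      linarith

open Classical in
lemma wCount_succ (S : Set ℕ) (n : ℕ) :
    (wCount S (n + 1) : ℤ) = wCount S n + if n + 1 ∈ S then 1 else 0 := by
  have hfin : (S ∩ Iic n).Finite := (finite_Iic n).inter_of_right S
  have hIic : Iic (n + 1) = insert (n + 1) (Iic n) := by
    ext m
    simp only [mem_Iic, mem_insert_iff]
    omega
  unfold wCount
  rw [hIic]
  split_ifs with h
  · rw [inter_insert_of_mem h, ncard_insert_of_notMem (by simp) hfin]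
    push_cast
    rfl
  · rw [inter_insert_of_notMem h, add_zero]

lemma wCount_zero {S : Set ℕ} (h : 0 ∉ S) : wCount S 0 = 0 := by
  have : S ∩ Iic 0 = ∅ := by
    ext m
    simp only [mem_inter_iff, mem_Iic, Nat.le_zero, mem_empty_iff_false, iff_false]
    rintro ⟨hm, rfl⟩
    exact h hm
  rw [wCount, this, ncard_empty]

lemma wCount_eq_floor {δ : ℝ} (h0 : 0 < δ) (h1 : δ < 1) {S : Set ℕ}
    (hS : ∀ n, n ∈ S ↔ 1 ≤ n ∧ fpart δ n < δ) (n : ℕ) :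
    (wCount S n : ℤ) = ⌊(n : ℝ) * δ + 1/2⌋ := by
  induction n with
  | zero =>
    rw [wCount_zero (by simp [hS])]
    norm_num
  | succ n ih =>
    rw [wCount_succ, ih]
    rcases fpart_succ_cases h0 h1 n with ⟨h, _, hf⟩ | ⟨h, _, hf⟩
    · rw [hf, if_neg (by rw [hS]; intro h'; linarith [h'.2]), add_zero]
    · rw [hf, if_pos ((hS _).2 ⟨by omega, h⟩)]

lemma wCount_WtC {α β : ℝ} (hα : α < 1/2) (n : ℕ) :
    (wCount (WtC α β) n : ℤ) = n - wCount (WtA α) n - wCount (WtB α β) n := by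
  induction n with
  | zero =>
    rw [wCount_zero (by simp [WtC]), wCount_zero (by simp [WtA]), wCount_zero (by simp [WtB])]
    rfl
  | succ n ih =>
    simp only [wCount_succ, ih]
    have hAB : ¬ (n + 1 ∈ WtA α ∧ n + 1 ∈ WtB α β) := by
      rintro ⟨⟨_, hA⟩, _, hB⟩
      rcases hB with h | h | h
      · linarith [h.1]
      · linarith [h.1]
      · linarith [h.1]
    have hC : n + 1 ∈ WtC α β ↔ n + 1 ∉ WtA α ∧ n + 1 ∉ WtB α β := by
      simp [WtC]
    by_cases hA : n + 1 ∈ WtA α <;> by_cases hB : n + 1 ∈ WtB α β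
    · exact absurd ⟨hA, hB⟩ hAB
    all_goals
      simp only [hC, hA, hB, not_true_eq_false, not_false_eq_true, and_true,
        and_false, if_true, if_false]
      push_cast
      ring

open Classical in
/-- `E_β(n)` is determined by the position of `(u_n, v_n)`. -/
lemma Ebeta_eq {α β : ℝ} (hα : 0 < α) (hβ : 0 < β) (hαi : Irrational α) (hβi : Irrational β)
    (hαhalf : α < 1/2) (hβhalf : β < 1/2) (n : ℕ) :
    Ebeta α β n =
      (if 1 - α < fpart α n ∧ 1 - β/2 < fpart β n then 1 else 0)
        - if fpart α n < α ∧ fpart β n < β/2 then 1 else 0 := by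
  induction n with
  | zero =>
    rw [Ebeta, wCount_zero (by simp [WtB]), wCount_zero (by simp [mem_wSet_iff hβ]), fpart_zero,
      fpart_zero, if_neg (by intro h; linarith [h.1]), if_neg (by intro h; linarith [h.1])]
    norm_num
  | succ n ih =>
    have hstep : Ebeta α β (n + 1) = Ebeta α β n + (if n + 1 ∈ WtB α β then 1 else 0)
        - if n + 1 ∈ wSet β then 1 else 0 := by
      simp only [Ebeta, wCount_succ]
      ring
    rw [hstep, ih]
    simp only [mem_wSet_iff hβ, WtB, mem_ofPred_eq]
    have hu0 := fpart_nonneg α n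
    have hu1 := fpart_lt_one α n
    have hu0' := fpart_nonneg α (n + 1)
    have hu1' := fpart_lt_one α (n + 1)
    have hv0 := fpart_nonneg β n
    have hv1 := fpart_lt_one β n
    have hv0' := fpart_nonneg β (n + 1)
    have hv1' := fpart_lt_one β (n + 1)
    have hα0 : fpart α (n + 1) ≠ 0 := by simpa using fpart_ne hαi (n + 1) 0 0
    have hα1 : fpart α (n + 1) ≠ α := by simpa using fpart_ne hαi (n + 1) 2 0
    have hα2 : fpart α (n + 1) ≠ 2 * α := by
      have := fpart_ne hαi (n + 1) 4 0
      push_cast at this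
      ring_nf at this ⊢
      exact this
    have hβ1 : fpart β (n + 1) ≠ β := by simpa using fpart_ne hβi (n + 1) 2 0
    have hβ2 : fpart β (n + 1) ≠ β / 2 := by simpa using fpart_ne hβi (n + 1) 1 0
    have hβ3 : fpart β (n + 1) ≠ 3 * β / 2 := by simpa using fpart_ne hβi (n + 1) 3 0
    have hu := fpart_succ_cases hα (by linarith) n
    have hv := fpart_succ_cases hβ (by linarith) n
    have h1 : 1 ≤ n + 1 := by omega
    simp only [h1, true_and]
    clear ih hstep
    generalize fpart α (n + 1) = u' at *
    generalize fpart β (n + 1) = v' at *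
    generalize fpart α n = u at *
    generalize fpart β n = v at *
    clear hαi hβi
    obtain ⟨b, rfl⟩ : ∃ b, β = 2 * b := ⟨β / 2, by ring⟩
    have e1 : 2 * b / 2 = b := by ring
    have e3 : 3 * (2 * b) / 2 = 3 * b := by ring
    rw [e1] at hβ2 ⊢
    rw [e3] at hβ3 ⊢
    rcases hu with ⟨hu, hu', -⟩ | ⟨hu, hu', -⟩ <;> rcases hv with ⟨hv, hv', -⟩ | ⟨hv, hv', -⟩
    · replace hα1 := lt_of_le_of_ne hu hα1.symm
      have c1 : ¬ (1 - α < u) := by linarith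
      have c2 : ¬ (u' < α) := by linarith
      have c3 : ¬ (v' < 2 * b) := by linarith
      have c4 : (u < α ∧ v < b) ↔ (α < u' ∧ u' < 2 * α ∧ 2 * b < v' ∧ v' < 3 * b) := by
        refine ⟨fun h => ⟨hα1, by linarith [h.1], lt_of_le_of_ne hv hβ1.symm, by linarith [h.2]⟩,
          fun h => ⟨by linarith [h.2.1], by linarith [h.2.2.2]⟩⟩
      have c5 : ¬ ((1 - α < u' ∧ 1 - b < v') ∧ α < u' ∧ u' < 2 * α ∧ 2 * b < v' ∧ v' < 3 * b) := by
        rintro ⟨⟨_, h⟩, _, _, _, h'⟩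
        linarith
      simp only [c4]
      by_cases d1 : 1 - α < u' ∧ 1 - b < v' <;>
        by_cases d2 : α < u' ∧ u' < 2 * α ∧ 2 * b < v' ∧ v' < 3 * b
      · exact absurd ⟨d1, d2⟩ c5
      all_goals simp [c1, c2, c3, d1, d2]
    · have c1 : ¬ (1 - α < u) := by linarith
      have c2 : ¬ (u' < α) := by linarith
      have c3 : ¬ (v < b) := by linarith
      have c4 : ¬ (1 - b < v') := by linarith
      simp [c1, c2, c3, c4, hv, lt_of_le_of_ne hu hα1.symm]
    · have c1 : ¬ (1 - b < v) := by linarith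
      have c2 : ¬ (u < α) := by linarith
      have c3 : ¬ (1 - α < u') := by linarith
      have c4 : ¬ (v' < b) := by linarith
      have c5 : ¬ (α < u') := by linarith
      have c6 : ¬ (v' < 2 * b) := by linarith
      simp [c1, c2, c3, c4, c5, c6]
    · have c1 : ¬ (u < α) := by linarith
      have c2 : ¬ (α < u') := by linarith
      have c3 : ¬ (1 - α < u') := by linarith
      have c4 : 1 - α < u := by
        have := lt_of_le_of_ne hu0' hα0.symm
        linarith
      have c5 : 1 - b < v ↔ ¬ (v' < b) := by
        rw [not_lt]
        exact ⟨fun h => by linarith, fun h => by linarith [lt_of_le_of_ne h hβ2.symm]⟩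
      by_cases d : v' < b <;> simp [c1, c2, c3, c4, c5, d, hu, hv]

lemma fpart_add_fpart_ne {α β γ : ℝ} (hγi : Irrational γ) (hsum : α + β + γ = 1) {n : ℕ}
    (hn : 1 ≤ n) {k : ℤ} : fpart α n + fpart β n ≠ k + 1/2 := by
  intro h
  have eα := floor_add_fpart α n
  have eβ := floor_add_fpart β n
  refine (hγi.natCast_mul (show n ≠ 0 by omega)).ne_rat
    (n + 1/2 - ⌊(n : ℝ) * α + 1/2⌋ - ⌊(n : ℝ) * β + 1/2⌋ - k) ?_
  push_cast
  rw [← eq_sub_iff_add_eq'] at hsum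
  rw [hsum]
  linarith

open Classical in
/-- `E_γ(n)` is determined by `E_β(n)` and the position of `(u_n, v_n)`. -/
lemma Egamma_eq {α β γ : ℝ} (hα : 0 < α) (hγ : 0 < γ) (hβ : 0 < β) (hγi : Irrational γ)
    (hsum : α + β + γ = 1) (hαhalf : α < 1/2) {n : ℕ} (hn : 1 ≤ n) :
    Egamma α β γ n =
      ((if 3/2 < fpart α n + fpart β n then 1 else 0)
        - if fpart α n + fpart β n < 1/2 then 1 else 0) - Ebeta α β n := by
  have hA := wCount_eq_floor (S := WtA α) hα (by linarith) (fun _ => Iff.rfl) n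
  have hB := wCount_eq_floor hβ (by linarith) (mem_wSet_iff hβ) n
  have hC := wCount_eq_floor hγ (by linarith) (mem_wSet_iff hγ) n
  have h1 : fpart α n + fpart β n ≠ 1/2 := by
    simpa using fpart_add_fpart_ne hγi hsum hn (k := 0)
  have h2 : fpart α n + fpart β n ≠ 3/2 := by
    have := fpart_add_fpart_ne hγi hsum hn (k := 1)
    norm_num at this ⊢
    exact this
  have eα := floor_add_fpart α n
  have eβ := floor_add_fpart β n
  have hγ' : γ = 1 - α - β := by linarith
  have hfl : ⌊(n : ℝ) * γ + 1/2⌋ = n - ⌊(n : ℝ) * α + 1/2⌋ - ⌊(n : ℝ) * β + 1/2⌋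
      + ⌊3/2 - (fpart α n + fpart β n)⌋ := by
    have : (n : ℝ) * γ + 1/2 = ((n - ⌊(n : ℝ) * α + 1/2⌋ - ⌊(n : ℝ) * β + 1/2⌋ : ℤ) : ℝ)
        + (3/2 - (fpart α n + fpart β n)) := by
      push_cast
      rw [hγ']
      linarith
    rw [this, Int.floor_intCast_add]
  have hu0 := fpart_nonneg α n
  have hu1 := fpart_lt_one α n
  have hv0 := fpart_nonneg β n
  have hv1 := fpart_lt_one β n
  have hlast : ⌊3/2 - (fpart α n + fpart β n)⌋
      = (if fpart α n + fpart β n < 1/2 then 1 else 0)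
        - if 3/2 < fpart α n + fpart β n then 1 else 0 := by
    rw [Int.floor_eq_iff]
    split_ifs <;> push_cast <;> constructor <;> grind
  rw [Egamma, wCount_WtC hαhalf, hA, hC, hfl, hlast, Ebeta, hB]
  ring

end Webster

/-- Densities of the counting-function errors `E_β` and `E_γ`. -/
theorem error_densities_counting (α β γ : ℝ)
    (hα : 0 < α) (hβ : 0 < β) (hγ : 0 < γ)
    (hαi : Irrational α) (hβi : Irrational β) (hγi : Irrational γ)
    (hsum : α + β + γ = 1) (hβhalf : β < 1/2) (hαγ : α < γ)
    (hindep : LinearIndependent ℚ ![(1 : ℝ), α, β]) :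
    HasDensity (Ebeta α β) 1 (α * β / 2) ∧
    HasDensity (Ebeta α β) (-1) (α * β / 2) ∧
    HasDensity (Ebeta α β) 0 (1 - α * β) ∧
    HasDensity (Egamma α β γ) 1 (1/8 - α * β / 2) ∧
    HasDensity (Egamma α β γ) (-1) (1/8 - α * β / 2) ∧
    HasDensity (Egamma α β γ) 0 (3/4 + α * β) := by
  classical
  have hαhalf : α < 1/2 := by linarith
  have hs : α ∈ Set.Icc (0 : ℝ) 1 := ⟨hα.le, by linarith⟩
  have ht : β / 2 ∈ Set.Icc (0 : ℝ) 1 := ⟨by linarith, by linarith⟩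
  have hhigh := predDensity_gt_and_gt hindep hs ht
  have hlow := predDensity_lt_and_lt hindep hs ht
  have hE := Ebeta_eq hα hβ hαi hβi hαhalf hβhalf
  have hG : ∀ n, 1 ≤ n → _ := fun n hn => Egamma_eq hα hγ hβ hγi hsum hαhalf hn
  have hβ_one : PredDensity (fun n => Ebeta α β n = 1) (α * (β / 2)) :=
    hhigh.congr fun n _ => by rw [hE]; grind
  have hβ_neg : PredDensity (fun n => Ebeta α β n = -1) (α * (β / 2)) :=
    hlow.congr fun n _ => by rw [hE]; grind
  have hβ_zero := ((predDensity_true.and_not hβ_one fun _ _ _ => trivial).and_not hβ_neg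
    fun n _ h => ⟨trivial, by omega⟩).congr (Q := fun n => Ebeta α β n = 0)
      fun n _ => by rw [hE]; grind
  have hγ_one := ((predDensity_lt_add hindep).and_not hhigh fun n _ h => by
    linarith [h.1, h.2]).congr (Q := fun n => Egamma α β γ n = 1)
      fun n hn => by rw [hG n hn, hE]; grind
  have hγ_neg := ((predDensity_add_lt hindep).and_not hlow fun n _ h => by
    linarith [h.1, h.2]).congr (Q := fun n => Egamma α β γ n = -1)
      fun n hn => by rw [hG n hn, hE]; grind
  have hγ_zero := ((predDensity_true.and_not hγ_one fun _ _ _ => trivial).and_not hγ_neg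
    fun n _ h => ⟨trivial, by omega⟩).congr (Q := fun n => Egamma α β γ n = 0)
      fun n hn => by rw [hG n hn, hE]; grind
  have e1 : α * (β / 2) = α * β / 2 := by ring
  have e2 : 1 - α * (β / 2) - α * (β / 2) = 1 - α * β := by ring
  have e3 : 1 - (1/8 - α * (β / 2)) - (1/8 - α * (β / 2)) = 3/4 + α * β := by ring
  rw [e2] at hβ_zero
  rw [e3] at hγ_zero
  rw [e1] at hβ_one hβ_neg hγ_one hγ_neg
  exact ⟨hβ_one, hβ_neg, hβ_zero, hγ_one, hγ_neg, hγ_zero⟩
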